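/- Noise outsourcing / omnirandomness of the Lebesgue measure: for every Markov kernel f : X → Y between standard Borel spaces X and Y, there exists a measurable function g : [0,1] × X → Y such that for every x ∈ X, the probability measure f(x) equals the pushforward of Lebesgue measure on [0,1] under the map r ↦ g(r, x). -/

import Mathlib

open MeasureTheory ProbabilityTheory

/-- **Noise outsourcing / omnirandomness of the Lebesgue measure**: for every Markov
kernel `f : X → Y` between standard Borel spaces there is a measurable function
`g : [0,1] × X → Y` such that for every `x`, the measure `f x` is the pushforward of
Lebesgue measure on `[0,1]` under `r ↦ g (r, x)`. -/
theorem noise_outsourcing {X Y : Type*} [MeasurableSpace X] [MeasurableSpace Y]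
    [StandardBorelSpace X] [StandardBorelSpace Y]
    (f : Kernel X Y) [IsMarkovKernel f] :
    ∃ g : unitInterval × X → Y, Measurable g ∧
      ∀ x, f x = (volume : Measure unitInterval).map (fun r => g (r, x)) := by
  rcases isEmpty_or_nonempty X with hX | ⟨⟨x₀⟩⟩
  · exact ⟨isEmptyElim, measurable_of_empty _, isEmptyElim⟩
  · have : Nonempty Y := (f x₀).nonempty_of_neZero
    obtain ⟨h, hh, hmap⟩ := f.exists_measurable_map_eq_unitInterval
    exact ⟨fun p => h p.2 p.1, hh.comp measurable_swap, fun x => (hmap x).symm⟩
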